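/- Let α > 0 be a real number, let M be an N×N real matrix with nonnegative entries such that every row of M contains a strictly positive entry, let C be the incidence matrix of M, and let s ∈ ℝ^N have all entries strictly positive. Define s' ∈ ℝ^N by s'_i = [ (M s)_i / (C s)_i ]^{1/(1+α)} · [ (C (s∘s))_i / (C s)_i ]^{α/(1+α)}. If in addition (M s)_i / (C s)_i < ‖s‖_∞ for every index i, then ‖s'‖_∞ < ‖s‖_∞; that is, the supremum norm of the error strictly decreases in one step of the Absolute Trust iteration when the error is large. -/

import Mathlib

open Matrix

/-- Incidence matrix of a nonnegative matrix: `C i j = 1` if `M i j > 0`, else `0`. -/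
noncomputable def incidence {N : ℕ} (M : Matrix (Fin N) (Fin N) ℝ) :
    Matrix (Fin N) (Fin N) ℝ :=
  fun i j => if 0 < M i j then 1 else 0

/-- A nonnegative matrix is irreducible iff its directed graph (edge `a → b` when
`M a b > 0`) is strongly connected. -/
def MatIrreducible {N : ℕ} (M : Matrix (Fin N) (Fin N) ℝ) : Prop :=
  ∀ i j : Fin N, Relation.TransGen (fun a b => 0 < M a b) i j

/-- The row sums of squares are at most the sup norm times the row sums, for rows of the
incidence matrix. -/
theorem incidence_mulVec_sq_le {N : ℕ} (M : Matrix (Fin N) (Fin N) ℝ) {s : Fin N → ℝ}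
    (hs : ∀ i, 0 ≤ s i) (i : Fin N) :
    (incidence M *ᵥ fun j => s j ^ 2) i ≤ ‖s‖ * (incidence M *ᵥ s) i := by
  simp only [mulVec, dotProduct, Finset.mul_sum]
  refine Finset.sum_le_sum fun j _ => ?_
  have hsj : s j ≤ ‖s‖ := (le_abs_self _).trans (norm_le_pi_norm s j)
  have hC : 0 ≤ incidence M i j := by unfold incidence; split_ifs <;> norm_num
  calc incidence M i j * s j ^ 2 = s j * (incidence M i j * s j) := by ring
    _ ≤ ‖s‖ * (incidence M i j * s j) :=
      mul_le_mul_of_nonneg_right hsj (mul_nonneg hC (hs j))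

theorem incidence_mulVec_pos {N : ℕ} {M : Matrix (Fin N) (Fin N) ℝ} {s : Fin N → ℝ}
    (hs : ∀ i, 0 < s i) {i : Fin N} (hi : ∃ j, 0 < M i j) :
    0 < (incidence M *ᵥ s) i := by
  obtain ⟨j, hj⟩ := hi
  refine Finset.sum_pos' (fun k _ => mul_nonneg ?_ (hs k).le) ⟨j, Finset.mem_univ j, ?_⟩
  · unfold incidence; split_ifs <;> norm_num
  · simpa [incidence, hj] using hs j

/-- A weighted geometric mean of two numbers at most `K`, the first strictly less, is less
than `K`. -/
theorem rpow_mul_rpow_lt_of_lt_of_le {x y K p q : ℝ} (hx : 0 ≤ x) (hy : 0 ≤ y)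
    (hxK : x < K) (hyK : y ≤ K) (hp : 0 < p) (hq : 0 ≤ q) (hpq : p + q = 1) :
    x ^ p * y ^ q < K := by
  have hK : 0 < K := hx.trans_lt hxK
  calc x ^ p * y ^ q ≤ x ^ p * K ^ q :=
        mul_le_mul_of_nonneg_left (Real.rpow_le_rpow hy hyK hq) (Real.rpow_nonneg hx p)
    _ < K ^ p * K ^ q :=
        mul_lt_mul_of_pos_right (Real.rpow_lt_rpow hx hxK hp) (Real.rpow_pos_of_pos hK q)
    _ = K := by rw [← Real.rpow_add hK, hpq, Real.rpow_one]

/-- One step of the Absolute Trust iteration strictly decreases the sup norm of the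
error when the φ₁-iterate is entrywise below the sup norm. -/
theorem sup_norm_decreases (N : ℕ) (hN : 0 < N) (α : ℝ) (hα : 0 < α)
    (M : Matrix (Fin N) (Fin N) ℝ) (hpos : ∀ i j, 0 ≤ M i j)
    (hrow : ∀ i, ∃ j, 0 < M i j)
    (s : Fin N → ℝ) (hs : ∀ i, 0 < s i)
    (s' : Fin N → ℝ)
    (hs' : ∀ i, s' i = ((M *ᵥ s) i / (incidence M *ᵥ s) i) ^ (1 / (1 + α)) *
        ((incidence M *ᵥ fun j => s j ^ 2) i / (incidence M *ᵥ s) i) ^ (α / (1 + α)))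
    (hlt : ∀ i, (M *ᵥ s) i / (incidence M *ᵥ s) i < ‖s‖) :
    ‖s'‖ < ‖s‖ := by
  have hK : 0 < ‖s‖ := (hs ⟨0, hN⟩).trans_le ((le_abs_self _).trans (norm_le_pi_norm s _))
  refine (pi_norm_lt_iff hK).2 fun i => ?_
  have hC : 0 < (incidence M *ᵥ s) i := incidence_mulVec_pos hs (hrow i)
  have hx : 0 ≤ (M *ᵥ s) i / (incidence M *ᵥ s) i :=
    div_nonneg (dotProduct_nonneg_of_nonneg (hpos i) fun j => (hs j).le) hC.le
  have hy : 0 ≤ (incidence M *ᵥ fun j => s j ^ 2) i / (incidence M *ᵥ s) i :=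
    div_nonneg (incidence_mulVec_pos (fun j => pow_pos (hs j) 2) (hrow i)).le hC.le
  rw [hs' i, Real.norm_of_nonneg (mul_nonneg (Real.rpow_nonneg hx _) (Real.rpow_nonneg hy _))]
  exact rpow_mul_rpow_lt_of_lt_of_le hx hy (hlt i)
    ((div_le_iff₀ hC).2 (incidence_mulVec_sq_le M (fun j => (hs j).le) i))
    (by positivity) (by positivity) (by field_simp)
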